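/- Let q be a prime number such that q divides a_j for every j ∈ {1,…,ϱ−1} and q does not divide d_j for any j ∈ {0,…,ϱ−1}. Then for every sequence (z_k)_{k≥1} of elements of {0,…,ϱ−1}, each rational number χ_H(Σ_{k=1}^{m} z_k ϱ^{k−1}) has denominator coprime to q (so it lies in the q-adic integers ℤ_q), and the sequence m ↦ χ_H(Σ_{k=1}^{m} z_k ϱ^{k−1}) converges in the field ℚ_q of q-adic numbers as m → ∞. -/

import Mathlib

/-- `Mstr a d l = ∏_{k=1}^{L} a_{j_k}/d_{j_k}` for the string `l = (j_1, …, j_L)`. -/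
def Mstr (a d : ℕ → ℤ) (l : List ℕ) : ℚ :=
  (l.map fun j => (a j : ℚ) / (d j : ℚ)).prod

/-- `chiStr a b d l = Σ_{m=1}^{L} (b_{j_m}/d_{j_m}) ∏_{k=1}^{m−1} a_{j_k}/d_{j_k}`. -/
def chiStr (a b d : ℕ → ℤ) (l : List ℕ) : ℚ :=
  ∑ m ∈ Finset.range l.length,
    ((l.map fun j => (b j : ℚ) / (d j : ℚ)).getD m 0) * Mstr a d (l.take m)

/-- `chiH a b d ϱ n = χ_H(j)` for the string `j` of base-`ϱ` digits of `n`
(least significant first, no trailing zeros); `chiH a b d ϱ 0 = 0`. -/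
def chiH (a b d : ℕ → ℤ) (ϱ n : ℕ) : ℚ := chiStr a b d (Nat.digits ϱ n)

theorem chiStr_nil (a b d : ℕ → ℤ) : chiStr a b d [] = 0 := by
  simp [chiStr]

theorem chiStr_cons (a b d : ℕ → ℤ) (j : ℕ) (l : List ℕ) :
    chiStr a b d (j :: l) = (b j : ℚ) / d j + (a j : ℚ) / d j * chiStr a b d l := by
  simp only [chiStr, List.length_cons, Finset.sum_range_succ', List.map_cons,
    List.getD_cons_succ, List.getD_cons_zero, List.take_succ_cons, List.take_zero, Mstr,
    List.prod_cons, List.map_nil, List.prod_nil, mul_one, Finset.mul_sum]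
  rw [add_comm]
  congr 1
  exact Finset.sum_congr rfl fun _ _ => by ring

theorem chiH_add_mul (a b d : ℕ → ℤ) (hb0 : b 0 = 0) {ϱ : ℕ} (hϱ : 2 ≤ ϱ) {j : ℕ} (hj : j < ϱ)
    (n : ℕ) :
    chiH a b d ϱ (j + ϱ * n) = (b j : ℚ) / d j + (a j : ℚ) / d j * chiH a b d ϱ n := by
  unfold chiH
  by_cases h : j ≠ 0 ∨ n ≠ 0
  · rw [Nat.digits_add ϱ hϱ j n hj h, chiStr_cons]
  · obtain ⟨rfl, rfl⟩ : j = 0 ∧ n = 0 := by simpa using h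
    simp [chiStr_nil, hb0]

theorem sum_digits_succ (ϱ : ℕ) (z : ℕ → ℕ) (m : ℕ) :
    ∑ k ∈ Finset.range (m + 1), z k * ϱ ^ k
      = z 0 + ϱ * ∑ k ∈ Finset.range m, z (k + 1) * ϱ ^ k := by
  rw [Finset.sum_range_succ', Finset.mul_sum, add_comm, pow_zero, mul_one]
  congr 1
  exact Finset.sum_congr rfl fun _ _ => by ring

theorem chiH_sum_digits (a b d : ℕ → ℤ) (hb0 : b 0 = 0) {ϱ : ℕ} (hϱ : 2 ≤ ϱ) (m : ℕ) :
    ∀ z : ℕ → ℕ, (∀ k, z k < ϱ) →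
      chiH a b d ϱ (∑ k ∈ Finset.range m, z k * ϱ ^ k)
        = ∑ k ∈ Finset.range m, (b (z k) : ℚ) / d (z k) *
            ∏ i ∈ Finset.range k, (a (z i) : ℚ) / d (z i) := by
  induction m with
  | zero => intro z _; simp [chiH, chiStr_nil]
  | succ m ih =>
    intro z hz
    rw [sum_digits_succ, chiH_add_mul a b d hb0 hϱ (hz 0), ih _ fun k => hz (k + 1),
      Finset.sum_range_succ', Finset.mul_sum, add_comm, Finset.prod_range_zero, mul_one]
    congr 1
    refine Finset.sum_congr rfl fun k _ => ?_
    rw [Finset.prod_range_succ']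
    ring

theorem coprime_den_intCast_div {q : ℕ} [hq : Fact q.Prime] (x : ℤ) {y : ℤ}
    (hy : ¬ (q : ℤ) ∣ y) : ((x : ℚ) / y).den.Coprime q := by
  refine ((Nat.Prime.coprime_iff_not_dvd hq.out).2 fun h => hy ?_).symm
  rw [← Rat.divInt_eq_div] at h
  exact (Int.natCast_dvd_natCast.2 h).trans (Rat.den_dvd x y)

theorem coprime_den_chiStr (a b d : ℕ → ℤ) {q : ℕ} [Fact q.Prime] {l : List ℕ}
    (hl : ∀ j ∈ l, ¬ (q : ℤ) ∣ d j) : (chiStr a b d l).den.Coprime q := by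
  induction l with
  | nil => simp [chiStr_nil]
  | cons j l ih =>
    rw [chiStr_cons]
    have hj := hl j List.mem_cons_self
    have hmul := Nat.Coprime.coprime_dvd_left (Rat.mul_den_dvd _ _)
      ((coprime_den_intCast_div (a j) hj).mul_left (ih fun i hi => hl i (List.mem_cons_of_mem _ hi)))
    exact Nat.Coprime.coprime_dvd_left (Rat.add_den_dvd _ _)
      ((coprime_den_intCast_div (b j) hj).mul_left hmul)

theorem norm_intCast_div_eq {q : ℕ} [Fact q.Prime] (x : ℤ) {y : ℤ} (hy : ¬ (q : ℤ) ∣ y) :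
    ‖(x : ℚ_[q]) / y‖ = ‖(x : ℚ_[q])‖ := by
  have h : ‖(y : ℚ_[q])‖ = 1 :=
    le_antisymm (Padic.norm_int_le_one y)
      (not_lt.1 fun h => hy (Padic.norm_intCast_lt_one_iff.1 h))
  rw [norm_div, h, div_one]

theorem norm_intCast_le_half {q : ℕ} [hq : Fact q.Prime] {x : ℤ} (hx : (q : ℤ) ∣ x) :
    ‖(x : ℚ_[q])‖ ≤ 1 / 2 := by
  obtain ⟨t, rfl⟩ := hx
  have h2 : (2 : ℝ) ≤ q := by exact_mod_cast hq.out.two_le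
  have h : ((q : ℝ))⁻¹ ≤ 1 / 2 := by
    rw [one_div]
    exact inv_anti₀ two_pos h2
  push_cast
  rw [norm_mul, Padic.norm_p]
  have := mul_le_mul h (Padic.norm_int_le_one (p := q) t) (norm_nonneg _) (by norm_num)
  simpa using this

/-- If each factor has norm at most one, and at most one half whenever the corresponding
coefficient is nonzero, then the series of coefficients times partial products converges. -/
theorem summable_mul_prod_range {K : Type*} [NormedField K] [CompleteSpace K] {c r : ℕ → K}
    (hc : ∀ k, ‖c k‖ ≤ 1) (hr : ∀ k, ‖r k‖ ≤ 1) (hcr : ∀ k, c k ≠ 0 → ‖r k‖ ≤ 1 / 2) :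
    Summable fun k => c k * ∏ i ∈ Finset.range k, r i := by
  set f : ℕ → ℝ := fun k => ‖∏ i ∈ Finset.range k, r i‖ with hf
  have hf0 : ∀ k, 0 ≤ f k := fun k => norm_nonneg _
  have hfs : ∀ k, f (k + 1) = f k * ‖r k‖ := fun k => by
    simp only [hf, Finset.prod_range_succ, norm_mul]
  have hterm : ∀ k, ‖c k * ∏ i ∈ Finset.range k, r i‖ ≤ 2 * (f k - f (k + 1)) := fun k => by
    rw [norm_mul, hfs]
    change ‖c k‖ * f k ≤ _
    by_cases h : c k = 0
    · rw [h, norm_zero]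
      nlinarith [hf0 k, hr k]
    · nlinarith [hf0 k, hc k, hcr k h, mul_le_mul_of_nonneg_left (hcr k h) (hf0 k),
        mul_le_mul_of_nonneg_right (hc k) (hf0 k)]
  refine Summable.of_norm (summable_of_sum_range_le (c := 2) (fun _ => norm_nonneg _) fun n => ?_)
  calc _ ≤ ∑ k ∈ Finset.range n, 2 * (f k - f (k + 1)) := Finset.sum_le_sum fun k _ => hterm k
    _ = 2 * (f 0 - f n) := by rw [← Finset.mul_sum, Finset.sum_range_sub']
    _ ≤ 2 := by
      have : f 0 = 1 := by simp [hf]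
      linarith [hf0 n]

/-- let `q` be a prime dividing `a_j` for every `j ∈ {1,…,ϱ−1}` and
dividing no `d_j`. Then for every sequence `(z_k)` of elements of `{0,…,ϱ−1}`,
each rational number `χ_H(Σ_{k=1}^{m} z_k ϱ^{k−1})` has denominator coprime to `q`
(so it lies in `ℤ_q`), and `m ↦ χ_H(Σ_{k=1}^{m} z_k ϱ^{k−1})` converges in `ℚ_q`. -/
theorem stmt8 (ϱ : ℕ) (hϱ : 2 ≤ ϱ) (a d b : ℕ → ℤ)
    (ha : ∀ j < ϱ, 0 < a j) (hd : ∀ j < ϱ, 0 < d j) (hb0 : b 0 = 0)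
    (q : ℕ) [hq : Fact q.Prime]
    (hqa : ∀ j, 1 ≤ j → j < ϱ → (q : ℤ) ∣ a j)
    (hqd : ∀ j < ϱ, ¬ (q : ℤ) ∣ d j)
    (z : ℕ → ℕ) (hz : ∀ k, z k < ϱ) :
    (∀ m : ℕ, Nat.Coprime (chiH a b d ϱ (∑ k ∈ Finset.range m, z k * ϱ ^ k)).den q)
    ∧ ∃ L : ℚ_[q], Filter.Tendsto
        (fun m : ℕ => ((chiH a b d ϱ (∑ k ∈ Finset.range m, z k * ϱ ^ k) : ℚ) : ℚ_[q]))
        Filter.atTop (nhds L) := by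
  refine ⟨fun m => coprime_den_chiStr a b d fun j hj => hqd j (Nat.digits_lt_base hϱ hj), ?_⟩
  have hsum : Summable fun k => (b (z k) : ℚ_[q]) / d (z k) *
      ∏ i ∈ Finset.range k, (a (z i) : ℚ_[q]) / d (z i) := by
    refine summable_mul_prod_range (fun k => ?_) (fun k => ?_) fun k hk => ?_
    · rw [norm_intCast_div_eq _ (hqd _ (hz k))]
      exact Padic.norm_int_le_one _
    · rw [norm_intCast_div_eq _ (hqd _ (hz k))]
      exact Padic.norm_int_le_one _
    · rw [norm_intCast_div_eq _ (hqd _ (hz k))]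
      have hzk : z k ≠ 0 := fun h => hk (by simp [h, hb0])
      exact norm_intCast_le_half (hqa _ (Nat.one_le_iff_ne_zero.2 hzk) (hz k))
  refine ⟨_, hsum.hasSum.tendsto_sum_nat.congr fun m => ?_⟩
  rw [chiH_sum_digits a b d hb0 hϱ m z hz]
  push_cast
  rfl
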